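/- arXiv:1609.06484 — 3 statements merged into one kernel-verified Lean document; each statement's English description precedes it below -/
import Mathlib

section
/- Let p ≥ 2 be an integer, let F be a finite set of nonzero integers, and let h ≥ 1 be an integer. There exists a constant K (depending only on p, F and h) such that for every integer N ≥ 2, the number of integers L with |L| ≤ N that can be written as L = ∑_{i=1}^h v_i · p^{t_i} with v_i ∈ F and t_i ∈ ℕ for each i, is at most K · (log N)^h. -/
/-- If the exponents of the nonzero terms are widely separated, the largest term dominates. -/
lemma exponent_le_of_separated {ι : Type*} [Fintype ι] [DecidableEq ι] {p : ℕ} (hp : 2 ≤ p)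
    {B T : ℕ} {v : ι → ℤ} {t : ι → ℕ} (hB : ∀ i, |v i| ≤ (B : ℤ))
    (hsep : ∀ i j, i ≠ j → v i ≠ 0 → v j ≠ 0 → t i ≤ t j →
      t i + 2 * Fintype.card ι * B < t j)
    (hT : |∑ i, v i * (p : ℤ) ^ t i| < (p : ℤ) ^ T) (k : ι) (hk : v k ≠ 0) : t k ≤ T := by
  obtain ⟨m, hm, hmax⟩ := Finset.exists_max_image (Finset.univ.filter fun i => v i ≠ 0) t
    ⟨k, by simpa using hk⟩
  simp only [Finset.mem_filter, Finset.mem_univ, true_and] at hm hmax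
  refine (hmax k hk).trans ?_
  have hp2 : (2 : ℤ) ≤ p := by exact_mod_cast hp
  have hterm : ∀ i ∈ Finset.univ.erase m,
      |v i * (p : ℤ) ^ t i| * (2 * Fintype.card ι) ≤ (p : ℤ) ^ t m := by
    intro i hi
    have him : i ≠ m := Finset.ne_of_mem_erase hi
    by_cases hvi : v i = 0
    · simp only [hvi, zero_mul, abs_zero]
      positivity
    have hgap := hsep i m him hvi hm (hmax i hvi)
    have hpow : ((2 * Fintype.card ι * B : ℕ) : ℤ) ≤ (p : ℤ) ^ (2 * Fintype.card ι * B) := by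
      exact_mod_cast (Nat.lt_pow_self hp).le
    calc |v i * (p : ℤ) ^ t i| * (2 * Fintype.card ι)
        = |v i| * (p : ℤ) ^ t i * (2 * Fintype.card ι) := by
          rw [abs_mul, abs_of_nonneg (by positivity : (0 : ℤ) ≤ (p : ℤ) ^ t i)]
      _ ≤ B * (p : ℤ) ^ t i * (2 * Fintype.card ι) := by gcongr; exact hB i
      _ = (p : ℤ) ^ t i * ((2 * Fintype.card ι * B : ℕ) : ℤ) := by push_cast; ring
      _ ≤ (p : ℤ) ^ t i * (p : ℤ) ^ (2 * Fintype.card ι * B) := by gcongr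
      _ = (p : ℤ) ^ (t i + 2 * Fintype.card ι * B) := (pow_add _ _ _).symm
      _ ≤ (p : ℤ) ^ t m := pow_le_pow_right₀ (by linarith) hgap.le
  have hcard : (0 : ℤ) < Fintype.card ι := by exact_mod_cast Fintype.card_pos_iff.2 ⟨k⟩
  have hrest : 2 * |∑ i ∈ Finset.univ.erase m, v i * (p : ℤ) ^ t i| ≤ (p : ℤ) ^ t m := by
    have hsum := Finset.sum_le_card_nsmul _ _ _ hterm
    rw [← Finset.sum_mul, nsmul_eq_mul] at hsum
    have hle : ((Finset.univ.erase m).card : ℤ) ≤ Fintype.card ι := by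
      exact_mod_cast Finset.card_le_univ _
    have habs := Finset.abs_sum_le_sum_abs (fun i => v i * (p : ℤ) ^ t i) (Finset.univ.erase m)
    have hpos : (0 : ℤ) ≤ (p : ℤ) ^ t m := by positivity
    refine le_of_mul_le_mul_right ?_ hcard
    nlinarith [mul_le_mul_of_nonneg_right hle hpos, mul_le_mul_of_nonneg_right habs hcard.le]
  have hlead : (p : ℤ) ^ t m ≤ |v m * (p : ℤ) ^ t m| := by
    rw [abs_mul, abs_of_nonneg (by positivity : (0 : ℤ) ≤ (p : ℤ) ^ t m)]
    exact le_mul_of_one_le_left (by positivity) (Int.one_le_abs hm)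
  rw [← Finset.add_sum_erase _ _ (Finset.mem_univ m)] at hT
  have htri := abs_sub_abs_le_abs_add (v m * (p : ℤ) ^ t m)
    (∑ i ∈ Finset.univ.erase m, v i * (p : ℤ) ^ t i)
  have hlt : (p : ℤ) ^ t m < (p : ℤ) ^ (T + 1) := by
    have : (0 : ℤ) < (p : ℤ) ^ T := by positivity
    rw [pow_succ]
    nlinarith
  exact Nat.lt_succ_iff.1 ((pow_lt_pow_iff_right₀ (by linarith)).1 hlt)

/-- A sum of boundedly many terms `v i * p ^ t i` with bounded coefficients and absolute value
less than `p ^ T` can be rewritten with all exponents at most `T`, at the cost of enlarging the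
bound on the coefficients. -/
lemma exists_bounded_exponents {ι : Type*} [Fintype ι] [DecidableEq ι] {p : ℕ} (hp : 2 ≤ p)
    (n B : ℕ) : ∃ B' : ℕ, ∀ (T : ℕ) (v : ι → ℤ) (t : ι → ℕ),
      (Finset.univ.filter fun i => v i ≠ 0).card ≤ n → (∀ i, |v i| ≤ (B : ℤ)) →
      |∑ i, v i * (p : ℤ) ^ t i| < (p : ℤ) ^ T →
      ∃ (v' : ι → ℤ) (t' : ι → ℕ), (∀ i, |v' i| ≤ (B' : ℤ)) ∧ (∀ i, t' i ≤ T) ∧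
        ∑ i, v i * (p : ℤ) ^ t i = ∑ i, v' i * (p : ℤ) ^ t' i := by
  induction n generalizing B with
  | zero =>
    refine ⟨0, fun T v t hn _ _ => ⟨0, 0, by simp, by simp, ?_⟩⟩
    have hv : ∀ i, v i = 0 := by simpa [Finset.filter_eq_empty_iff] using hn
    simp [hv]
  | succ n ih =>
    set D := 2 * Fintype.card ι * B with hD
    obtain ⟨B', hB'⟩ := ih (B + B * p ^ D)
    refine ⟨max B B', fun T v t hn hB hT => ?_⟩
    by_cases hsep : ∀ i j, i ≠ j → v i ≠ 0 → v j ≠ 0 → t i ≤ t j → t i + D < t j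
    · refine ⟨v, fun i => if v i = 0 then 0 else t i, fun i => (hB i).trans ?_, fun i => ?_, ?_⟩
      · exact_mod_cast le_max_left _ _
      · dsimp only
        split_ifs with hi
        · exact Nat.zero_le _
        · exact exponent_le_of_separated hp hB hsep hT i hi
      · refine Finset.sum_congr rfl fun i _ => ?_
        by_cases hi : v i = 0 <;> simp [hi]
    push Not at hsep
    obtain ⟨i, j, hij, hi, hj, hle, hgap⟩ := hsep
    set w : ι → ℤ := Function.update (Function.update v i (v i + v j * (p : ℤ) ^ (t j - t i))) j 0
      with hw
    have hwj : w j = 0 := by simp [hw]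
    have hwi : w i = v i + v j * (p : ℤ) ^ (t j - t i) := by simp [hw, hij]
    have hwk : ∀ k, k ≠ i → k ≠ j → w k = v k := fun k h₁ h₂ => by simp [hw, h₁, h₂]
    have hsum : ∑ k, v k * (p : ℤ) ^ t k = ∑ k, w k * (p : ℤ) ^ t k := by
      have hji : j ∈ Finset.univ.erase i := by simp [hij.symm]
      rw [← Finset.add_sum_erase _ _ (Finset.mem_univ i), ← Finset.add_sum_erase _ _ hji,
        ← Finset.add_sum_erase _ (fun k => w k * (p : ℤ) ^ t k) (Finset.mem_univ i),
        ← Finset.add_sum_erase _ (fun k => w k * (p : ℤ) ^ t k) hji, hwi, hwj,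
        Finset.sum_congr rfl fun k hk => ?_, add_mul, mul_assoc, ← pow_add,
        Nat.sub_add_cancel hle]
      · ring
      · simp only [Finset.mem_erase, Finset.mem_univ, and_true] at hk
        rw [hwk k hk.2 hk.1]
    have hwn : (Finset.univ.filter fun k => w k ≠ 0).card ≤ n := by
      refine Nat.lt_succ_iff.1 (lt_of_lt_of_le (Finset.card_lt_card ?_) hn)
      refine (Finset.ssubset_iff_of_subset fun k hk => ?_).2 ⟨j, by simpa using hj, by simp [hwj]⟩
      simp only [Finset.mem_filter, Finset.mem_univ, true_and] at hk ⊢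
      by_cases hki : k = i
      · exact hki ▸ hi
      by_cases hkj : k = j
      · exact hkj ▸ hj
      · rwa [hwk k hki hkj] at hk
    have hwB : ∀ k, |w k| ≤ ((B + B * p ^ D : ℕ) : ℤ) := by
      intro k
      push_cast
      have hnn : (0 : ℤ) ≤ (B : ℤ) * (p : ℤ) ^ D := by positivity
      by_cases hkj : k = j
      · rw [hkj, hwj, abs_zero]
        positivity
      by_cases hki : k = i
      · rw [hki, hwi]
        refine (abs_add_le _ _).trans (add_le_add (hB i) ?_)
        rw [abs_mul, abs_of_nonneg (by positivity : (0 : ℤ) ≤ (p : ℤ) ^ (t j - t i))]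
        have hp1 : (1 : ℤ) ≤ p := by exact_mod_cast (by omega : 1 ≤ p)
        have hexp : t j - t i ≤ D := by omega
        gcongr
        exact hB j
      · rw [hwk k hki hkj]
        linarith [hB k]
    obtain ⟨v', t', h₁, h₂, h₃⟩ := hB' T w t hwn hwB (hsum ▸ hT)
    exact ⟨v', t', fun k => (h₁ k).trans (by exact_mod_cast le_max_right _ _), h₂, hsum.trans h₃⟩

lemma natLog_add_two_le {p N : ℕ} (hp : 2 ≤ p) (hN : 2 ≤ N) :
    ((Nat.log p N + 2 : ℕ) : ℝ) ≤ 3 / Real.log 2 * Real.log N := by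
  have hlog2 : 0 < Real.log 2 := Real.log_pos (by norm_num)
  have hpow : ((2 : ℝ) ^ Nat.log p N) ≤ N := by
    exact_mod_cast (Nat.pow_le_pow_left hp _).trans (Nat.pow_log_le_self p (by omega))
  have h₁ : (Nat.log p N : ℝ) * Real.log 2 ≤ Real.log N := by
    rw [← Real.log_pow]
    exact Real.log_le_log (by positivity) hpow
  have h₂ : Real.log 2 ≤ Real.log N :=
    Real.log_le_log (by norm_num) (by exact_mod_cast hN)
  rw [div_mul_eq_mul_div, le_div_iff₀ hlog2]
  push_cast
  nlinarith

open Classical in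
theorem stmt_6 (p : ℕ) (hp : 2 ≤ p) (F : Finset ℤ) (hF : (0 : ℤ) ∉ F)
    (h : ℕ) (hh : 1 ≤ h) :
    ∃ K : ℝ, ∀ N : ℕ, 2 ≤ N →
      (((Finset.Icc (-(N : ℤ)) (N : ℤ)).filter fun L =>
          ∃ v : Fin h → ℤ, ∃ t : Fin h → ℕ,
            (∀ i, v i ∈ F) ∧ L = ∑ i, v i * (p : ℤ) ^ t i).card : ℝ)
      ≤ K * Real.log N ^ h := by
  obtain ⟨B, hB⟩ : ∃ B : ℕ, ∀ x ∈ F, |x| ≤ (B : ℤ) := by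
    refine ⟨F.sup Int.natAbs, fun x hx => ?_⟩
    rw [Int.abs_eq_natAbs]
    exact_mod_cast Finset.le_sup (f := Int.natAbs) hx
  obtain ⟨B', hB'⟩ := exists_bounded_exponents (ι := Fin h) hp h B
  refine ⟨((2 * B' + 1 : ℕ) * (3 / Real.log 2)) ^ h, fun N hN => ?_⟩
  set T := Nat.log p N + 1 with hTdef
  let A : Finset (Fin h → ℤ × ℕ) :=
    Fintype.piFinset fun _ => Finset.Icc (-(B' : ℤ)) B' ×ˢ Finset.range (T + 1)
  have hA : A.card = ((2 * B' + 1) * (T + 1)) ^ h := by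
    simp only [A, Fintype.card_piFinset, Finset.card_product, Int.card_Icc, Finset.card_range,
      Finset.prod_const, Finset.card_univ, Fintype.card_fin]
    congr 2
    omega
  have hcard : ((Finset.Icc (-(N : ℤ)) (N : ℤ)).filter fun L =>
      ∃ v : Fin h → ℤ, ∃ t : Fin h → ℕ,
        (∀ i, v i ∈ F) ∧ L = ∑ i, v i * (p : ℤ) ^ t i).card ≤ A.card := by
    refine (Finset.card_le_card fun L hL => ?_).trans
      (Finset.card_image_le (s := A) (f := fun f => ∑ i, (f i).1 * (p : ℤ) ^ (f i).2))
    simp only [Finset.mem_filter, Finset.mem_Icc] at hL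
    obtain ⟨hLN, v, t, hv, rfl⟩ := hL
    have hNT : (N : ℤ) < (p : ℤ) ^ T := by
      exact_mod_cast Nat.lt_pow_succ_log_self (by omega : 1 < p) N
    obtain ⟨v', t', h₁, h₂, h₃⟩ := hB' T v t ((Finset.card_le_univ _).trans (by simp))
      (fun i => hB _ (hv i)) ((abs_le.2 hLN).trans_lt hNT)
    refine Finset.mem_image.2 ⟨fun i => (v' i, t' i), ?_, h₃.symm⟩
    simp only [A, Fintype.mem_piFinset, Finset.mem_product, Finset.mem_Icc, Finset.mem_range]
    exact fun i => ⟨abs_le.1 (h₁ i), Nat.lt_succ_of_le (h₂ i)⟩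
  calc _ ≤ (A.card : ℝ) := by exact_mod_cast hcard
    _ = ((2 * B' + 1 : ℕ) * ((Nat.log p N + 2 : ℕ) : ℝ)) ^ h := by rw [hA, hTdef]; push_cast; ring
    _ ≤ ((2 * B' + 1 : ℕ) * (3 / Real.log 2 * Real.log N)) ^ h := by
      gcongr
      exact natLog_add_two_le hp hN
    _ = _ := by rw [← mul_pow, mul_assoc]
end

section
/- Let p be a prime, d ≥ 1, and let R_1, …, R_d ∈ 𝔽_p[x] be pairwise distinct monic irreducible polynomials. For every integer r ≥ 1 there exist constants K > 0 and γ > 0 such that for every finite nonempty set D ⊆ ℕ^d, the number of special R-polynomials Γ ∈ 𝔽_p[X_1, …, X_d] whose support is contained in D and has cardinality exactly r is at most K · |D|^{r/3} · (1 + log(1 + diam D))^γ. -/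
/-- The diameter of a finite set of exponent vectors in `ℕ^d`:
`max_{a,b ∈ D} max_i |a_i - b_i|`. -/
def expDiam {d : ℕ} (D : Finset (Fin d →₀ ℕ)) : ℕ :=
  D.sup fun a => D.sup fun b => Finset.univ.sup fun i : Fin d => ((a i : ℤ) - (b i : ℤ)).natAbs

section FrobeniusKernel

open Polynomial

variable (p : ℕ) [Fact p.Prime]

theorem exists_eq_algebraMap_div_pow (x : FractionRing (ZMod p)[X]) :
    ∃ a b : (ZMod p)[X], b ≠ 0 ∧ x = algebraMap _ (FractionRing (ZMod p)[X]) a /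
      (algebraMap _ (FractionRing (ZMod p)[X]) b) ^ p := by
  obtain ⟨a, b, hb, rfl⟩ := IsFractionRing.div_surjective (A := (ZMod p)[X]) x
  have hb0 : b ≠ 0 := nonZeroDivisors.ne_zero hb
  refine ⟨a * b ^ (p - 1), b, hb0, ?_⟩
  have hb' : algebraMap _ (FractionRing (ZMod p)[X]) b ≠ 0 := by simpa using hb0
  have hp : p - 1 + 1 = p := Nat.sub_add_cancel (Fact.out : p.Prime).one_le
  rw [div_eq_div_iff hb' (pow_ne_zero _ hb'), map_mul, map_pow, mul_assoc, ← pow_succ, hp]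

theorem derivative_mul_pow_char (a b : (ZMod p)[X]) :
    derivative (a * b ^ p) = derivative a * b ^ p := by
  rw [derivative_mul, derivative_pow]
  simp

/-- The derivation of `𝔽_p(x)` extending `d/dx`, as an additive map: its kernel is the subfield
of `p`-th powers. -/
theorem exists_addMonoidHom_ker_eq_pow :
    ∃ φ : FractionRing (ZMod p)[X] →+ FractionRing (ZMod p)[X],
      (∀ x y, φ (y ^ p * x) = y ^ p * φ x) ∧ ∀ x, φ x = 0 ↔ ∃ y, x = y ^ p := by
  choose num den hden hx using exists_eq_algebraMap_div_pow p
  let ι := algebraMap (ZMod p)[X] (FractionRing (ZMod p)[X])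
  have hι : ∀ b, b ≠ 0 → ι b ≠ 0 := fun b hb => by simpa [ι] using hb
  let D : FractionRing (ZMod p)[X] → FractionRing (ZMod p)[X] :=
    fun x => ι (derivative (num x)) / ι (den x) ^ p
  have key : ∀ a b, b ≠ 0 → D (ι a / ι b ^ p) = ι (derivative a) / ι b ^ p := by
    intro a b hb
    have h := hx (ι a / ι b ^ p)
    generalize hy : ι a / ι b ^ p = y at h ⊢
    rw [← hy, div_eq_div_iff (pow_ne_zero _ (hι _ hb)) (pow_ne_zero _ (hι _ (hden _))), hy] at h
    change _ / _ = _
    rw [div_eq_div_iff (pow_ne_zero _ (hι _ (hden _))) (pow_ne_zero _ (hι _ hb))]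
    have h' : a * den y ^ p = num y * b ^ p := by
      apply IsFractionRing.injective (ZMod p)[X] (FractionRing (ZMod p)[X])
      simpa only [map_mul, map_pow] using h
    have h2 := congrArg derivative h'
    rw [derivative_mul_pow_char, derivative_mul_pow_char] at h2
    rw [← map_pow, ← map_pow, ← map_mul, ← map_mul, h2]
  refine ⟨AddMonoidHom.mk' D ?_, ?_, ?_⟩
  · intro x y
    obtain ⟨a, b, hb, rfl⟩ := exists_eq_algebraMap_div_pow p x
    obtain ⟨c, e, he, rfl⟩ := exists_eq_algebraMap_div_pow p y
    have h1 : ι a / ι b ^ p + ι c / ι e ^ p = ι (a * e ^ p + c * b ^ p) / ι (b * e) ^ p := by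
      have := hι _ hb
      have := hι _ he
      simp only [map_add, map_mul, map_pow, mul_pow]
      field_simp
    change D (ι a / ι b ^ p + ι c / ι e ^ p) = D (ι a / ι b ^ p) + D (ι c / ι e ^ p)
    rw [h1, key _ _ hb, key _ _ he, key _ _ (mul_ne_zero hb he), derivative_add,
      derivative_mul_pow_char, derivative_mul_pow_char]
    have := hι _ hb
    have := hι _ he
    simp only [map_add, map_mul, map_pow, mul_pow]
    field_simp
  · intro x y
    obtain ⟨a, b, hb, rfl⟩ := exists_eq_algebraMap_div_pow p x
    obtain ⟨c, e, he, rfl⟩ := IsFractionRing.div_surjective (A := (ZMod p)[X]) y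
    have he : e ≠ 0 := nonZeroDivisors.ne_zero he
    have h1 : (ι c / ι e) ^ p * (ι a / ι b ^ p) = ι (a * c ^ p) / ι (b * e) ^ p := by
      have := hι _ hb
      have := hι _ he
      simp only [map_mul, map_pow, mul_pow, div_pow]
      field_simp
    change D ((ι c / ι e) ^ p * (ι a / ι b ^ p)) = (ι c / ι e) ^ p * D (ι a / ι b ^ p)
    rw [h1, key _ _ hb, key _ _ (mul_ne_zero hb he), derivative_mul_pow_char]
    have := hι _ hb
    have := hι _ he
    simp only [map_mul, map_pow, mul_pow, div_pow]
    field_simp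
  · intro x
    obtain ⟨a, b, hb, rfl⟩ := exists_eq_algebraMap_div_pow p x
    change D (ι a / ι b ^ p) = 0 ↔ ∃ y, ι a / ι b ^ p = y ^ p
    rw [key _ _ hb]
    constructor
    · intro h
      have h' : derivative a = 0 := by
        have := hι (derivative a)
        by_contra h0
        exact div_ne_zero (this h0) (pow_ne_zero _ (hι _ hb)) h
      have h2 := expand_contract p h' (Fact.out : p.Prime).ne_zero
      rw [ZMod.expand_card] at h2
      refine ⟨ι (contract p a) / ι b, ?_⟩
      rw [div_pow, ← map_pow ι (contract p a), h2]
    · rintro ⟨y, hy⟩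
      obtain ⟨c, e, he, rfl⟩ := IsFractionRing.div_surjective (A := (ZMod p)[X]) y
      have he : e ≠ 0 := nonZeroDivisors.ne_zero he
      have h1 : ι a / ι b ^ p = ι (1 * c ^ p) / ι e ^ p := by
        rw [hy, div_pow, one_mul, map_pow]
      rw [← key _ _ hb, h1, key _ _ he, derivative_mul_pow_char]
      simp

end FrobeniusKernel

section MonicIrreducibles

open Polynomial

variable {p : ℕ} [Fact p.Prime] {δ : Type*} [Fintype δ]

/-- The character `a ↦ ∏ R_j ^ a_j` of `ℤ^δ` with values in `𝔽_p(x)`. -/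
noncomputable def prodZPow (R : δ → (ZMod p)[X]) (hR : ∀ j, R j ≠ 0) :
    AddChar (δ → ℤ) (FractionRing (ZMod p)[X]) where
  toFun a := ∏ j, algebraMap _ (FractionRing (ZMod p)[X]) (R j) ^ a j
  map_zero_eq_one' := by simp
  map_add_eq_mul' a b := by
    rw [← Finset.prod_mul_distrib]
    refine Finset.prod_congr rfl fun j _ => ?_
    rw [Pi.add_apply, zpow_add₀]
    simpa using hR j

theorem prodZPow_natCast (R : δ → (ZMod p)[X]) (hR : ∀ j, R j ≠ 0) (n : δ → ℕ) :
    prodZPow R hR (fun j => (n j : ℤ)) =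
      algebraMap _ (FractionRing (ZMod p)[X]) (∏ j, R j ^ n j) := by
  rw [map_prod]
  exact Finset.prod_congr rfl fun j _ => by simp

theorem emultiplicity_prod_pow_irreducible [DecidableEq δ] (R : δ → (ZMod p)[X])
    (hR : ∀ j, (R j).Monic ∧ Irreducible (R j)) (hinj : Function.Injective R) (n : δ → ℕ) (j : δ) :
    emultiplicity (R j) (∏ i, R i ^ n i) = n j := by
  rw [Finset.emultiplicity_prod (hR j).2.prime, Finset.sum_eq_single j]
  · exact emultiplicity_pow_self_of_prime (hR j).2.prime _
  · intro i _ hij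
    rw [emultiplicity_pow (hR j).2.prime, emultiplicity_eq_zero.2, mul_zero]
    intro h
    have h1 := (hR j).2.associated_of_dvd (hR i).2 h
    exact hij (hinj (eq_of_monic_of_associated (hR j).1 (hR i).1 h1)).symm
  · simp

theorem dvd_of_prodZPow_eq_pow (R : δ → (ZMod p)[X]) (hR : ∀ j, (R j).Monic ∧ Irreducible (R j))
    (hinj : Function.Injective R) (a : δ → ℤ) (y : FractionRing (ZMod p)[X])
    (h : prodZPow R (fun j => (hR j).2.ne_zero) a = y ^ p) (j : δ) : (p : ℤ) ∣ a j := by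
  classical
  have hp : p.Prime := Fact.out
  let u := prodZPow R (fun j => (hR j).2.ne_zero)
  let M : δ → ℤ := fun i => |a i|
  have hM : ∀ i, 0 ≤ a i + p * M i := fun i => by
    have h1 : (1 : ℤ) ≤ p := by exact_mod_cast hp.one_le
    have h2 := neg_abs_le (a i)
    have h3 := abs_nonneg (a i)
    simp only [M]
    nlinarith
  have h1 : u (fun i => ((a i + p * M i).toNat : ℤ)) = (y * u M) ^ p := by
    have : (fun i => ((a i + p * M i).toNat : ℤ)) = a + p • M := by
      funext i
      rw [Int.toNat_of_nonneg (hM i)]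
      simp
    rw [this, AddChar.map_add_eq_mul, AddChar.map_nsmul_eq_pow, mul_pow, ← h]
  generalize y * u M = z at h1
  obtain ⟨c, e, he, rfl⟩ := IsFractionRing.div_surjective (A := (ZMod p)[X]) z
  have he : e ≠ 0 := nonZeroDivisors.ne_zero he
  have he' : algebraMap _ (FractionRing (ZMod p)[X]) e ≠ 0 := by simpa using he
  rw [prodZPow_natCast, div_pow, eq_div_iff (pow_ne_zero _ he'), ← map_pow, ← map_pow,
    ← map_mul] at h1
  have h2 := IsFractionRing.injective (ZMod p)[X] (FractionRing (ZMod p)[X]) h1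
  have hP : ∏ i, R i ^ (a i + p * M i).toNat ≠ 0 :=
    Finset.prod_ne_zero_iff.2 fun i _ => pow_ne_zero _ (hR i).2.ne_zero
  have hc : c ≠ 0 := by
    rintro rfl
    rw [zero_pow hp.ne_zero] at h2
    exact mul_ne_zero hP (pow_ne_zero _ he) h2
  have h3 := congrArg (emultiplicity (R j)) h2
  have fin : ∀ q : (ZMod p)[X], q ≠ 0 → FiniteMultiplicity (R j) q := fun q hq =>
    FiniteMultiplicity.of_prime_left (hR j).2.prime hq
  rw [emultiplicity_mul (hR j).2.prime, emultiplicity_prod_pow_irreducible R hR hinj,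
    emultiplicity_pow (hR j).2.prime, emultiplicity_pow (hR j).2.prime,
    (fin e he).emultiplicity_eq_multiplicity, (fin c hc).emultiplicity_eq_multiplicity] at h3
  have h4 : (a j + p * M j).toNat + p * multiplicity (R j) e = p * multiplicity (R j) c := by
    exact_mod_cast h3
  have h5 : a j + p * M j + p * multiplicity (R j) e = p * multiplicity (R j) c := by
    rw [← Int.toNat_of_nonneg (hM j)]
    exact_mod_cast h4
  exact ⟨multiplicity (R j) c - multiplicity (R j) e - M j, by linear_combination h5⟩

end MonicIrreducibles

section Cover

variable {α β κ : Type*}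

/-- `S` is contained in a finite set with at most `n` elements. -/
def HasCover (S : Set α) (n : ℕ) : Prop := ∃ F : Finset α, S ⊆ F ∧ F.card ≤ n

theorem HasCover.mono {S T : Set α} {m n : ℕ} (h : HasCover S m) (hT : T ⊆ S) (hmn : m ≤ n) :
    HasCover T n :=
  let ⟨F, hF, hc⟩ := h
  ⟨F, hT.trans hF, hc.trans hmn⟩

theorem HasCover.empty (n : ℕ) : HasCover (∅ : Set α) n := ⟨∅, by simp, by simp⟩

theorem HasCover.image {S : Set α} {n : ℕ} (h : HasCover S n) (g : α → β) :
    HasCover (g '' S) n := by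
  classical
  obtain ⟨F, hF, hc⟩ := h
  refine ⟨F.image g, ?_, Finset.card_image_le.trans hc⟩
  rw [Finset.coe_image]
  exact Set.image_mono hF

theorem HasCover.union {S T : Set α} {m n : ℕ} (hS : HasCover S m) (hT : HasCover T n) :
    HasCover (S ∪ T) (m + n) := by
  classical
  obtain ⟨F, hF, hc⟩ := hS
  obtain ⟨G, hG, hd⟩ := hT
  refine ⟨F ∪ G, ?_, (Finset.card_union_le _ _).trans (add_le_add hc hd)⟩
  rw [Finset.coe_union]
  exact Set.union_subset_union hF hG

theorem HasCover.biUnion {A : Set κ} {m n : ℕ} (hA : HasCover A m) {T : κ → Set α}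
    (hT : ∀ k, HasCover (T k) n) : HasCover (⋃ k ∈ A, T k) (m * n) := by
  classical
  obtain ⟨F, hF, hc⟩ := hA
  choose G hG hn using hT
  refine ⟨F.biUnion G, ?_,
    (Finset.card_biUnion_le_card_mul _ _ n fun k _ => hn k).trans (Nat.mul_le_mul_right _ hc)⟩
  intro x hx
  simp only [Set.mem_iUnion] at hx
  obtain ⟨k, hk, hx⟩ := hx
  exact Finset.mem_coe.2 (Finset.mem_biUnion.2 ⟨k, hF hk, hG k hx⟩)

theorem HasCover.iUnion [Fintype κ] {n : ℕ} {T : κ → Set α} (hT : ∀ k, HasCover (T k) n) :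
    HasCover (⋃ k, T k) (Fintype.card κ * n) := by
  have hu : HasCover (Set.univ : Set κ) (Fintype.card κ) := ⟨Finset.univ, by simp, le_rfl⟩
  simpa using hu.biUnion hT

theorem HasCover.ncard_le {S : Set α} {n : ℕ} (h : HasCover S n) : S.ncard ≤ n := by
  obtain ⟨F, hF, hc⟩ := h
  calc S.ncard ≤ (F : Set α).ncard := Set.ncard_le_ncard hF F.finite_toSet
    _ = F.card := Set.ncard_coe_finset F
    _ ≤ n := hc

theorem exists_hasCover_abs_le {ι δ : Type*} [Fintype ι] [Fintype δ] (M : ℕ) :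
    ∃ n, HasCover {a : ι → δ → ℤ | ∀ i j, |a i j| ≤ M} n := by
  have h : {a : ι → δ → ℤ | ∀ i j, |a i j| ≤ M}.Finite :=
    (Set.Finite.pi' fun _ => Set.Finite.pi' fun _ => Set.finite_Icc (-(M : ℤ)) M).subset
      fun a ha i j => abs_le.1 (ha i j)
  exact ⟨_, h.toFinset, by simp, le_rfl⟩

end Cover

section MinimalRelation

variable {ι K : Type*} [Field K]

/-- The sum of `v` over `s` vanishes, but no sum over a nonempty proper subset of `s` does. -/
def IsMinimalRelation (s : Finset ι) (v : ι → K) : Prop :=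
  ∑ i ∈ s, v i = 0 ∧ ∀ t ⊂ s, t.Nonempty → ∑ i ∈ t, v i ≠ 0

theorem exists_isMinimalRelation (v : ι → K) (s : Finset ι) (hs : s.Nonempty)
    (h : ∑ i ∈ s, v i = 0) : ∃ t ⊆ s, t.Nonempty ∧ IsMinimalRelation t v := by
  induction s using Finset.strongInduction with
  | H s ih =>
    by_cases hm : ∀ t ⊂ s, t.Nonempty → ∑ i ∈ t, v i ≠ 0
    · exact ⟨s, subset_rfl, hs, h, hm⟩
    · push Not at hm
      obtain ⟨t, hts, ht, ht0⟩ := hm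
      obtain ⟨t', h1, h2⟩ := ih t hts ht ht0
      exact ⟨t', h1.trans hts.1, h2⟩

theorem IsMinimalRelation.const_mul {s : Finset ι} {v w : ι → K} (h : IsMinimalRelation s v) {c : K}
    (hc : c ≠ 0) (hw : ∀ i ∈ s, w i = c * v i) : IsMinimalRelation s w := by
  have key : ∀ t ⊆ s, ∑ i ∈ t, w i = c * ∑ i ∈ t, v i := fun t ht => by
    rw [Finset.mul_sum]
    exact Finset.sum_congr rfl fun i hi => hw i (ht hi)
  refine ⟨by rw [key s subset_rfl, h.1, mul_zero], fun t ht hn => ?_⟩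
  rw [key t ht.1]
  exact mul_ne_zero hc (h.2 t ht hn)

theorem IsMinimalRelation.of_pow {p : ℕ} [Fact p.Prime] [CharP K p] {s : Finset ι} {v w : ι → K}
    (h : IsMinimalRelation s v) (hw : ∀ i ∈ s, v i = w i ^ p) : IsMinimalRelation s w := by
  have key : ∀ t ⊆ s, ∑ i ∈ t, v i = (∑ i ∈ t, w i) ^ p := fun t ht => by
    rw [sum_pow_char]
    exact Finset.sum_congr rfl fun i hi => hw i (ht hi)
  have hp : p ≠ 0 := (Fact.out : p.Prime).ne_zero
  refine ⟨?_, fun t ht hn h0 => ?_⟩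
  · have := h.1
    rw [key s subset_rfl] at this
    exact eq_zero_of_pow_eq_zero this
  · apply h.2 t ht hn
    rw [key t ht.1, h0, zero_pow hp]

/-- Merging the terms of a minimal relation indexed by `J` into the single term `j₀ ∈ J`. -/
theorem IsMinimalRelation.merge [DecidableEq ι] {s J : Finset ι} {v w : ι → K}
    (h : IsMinimalRelation s v) (hJ : J ⊆ s) {j₀ : ι} (hj : j₀ ∈ J)
    (hw : ∀ i, i ∉ J → w i = v i) (hw₀ : w j₀ = ∑ i ∈ J, v i) :
    IsMinimalRelation (s \ J.erase j₀) w := by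
  have key₁ : ∀ t ⊆ s \ J.erase j₀, j₀ ∈ t → ∑ i ∈ t, w i = ∑ i ∈ t ∪ J, v i := by
    intro t ht hjt
    have h1 : t ∪ J = t.erase j₀ ∪ J := by
      ext i
      by_cases hi : i = j₀
      · subst hi; simp [hj]
      · simp [hi]
    have hd : ∀ i ∈ t.erase j₀, i ∉ J := fun i hi hiJ => by
      obtain ⟨hne, hit⟩ := Finset.mem_erase.1 hi
      exact (Finset.mem_sdiff.1 (ht hit)).2 (Finset.mem_erase.2 ⟨hne, hiJ⟩)
    rw [h1, Finset.sum_union (Finset.disjoint_left.2 hd), ← hw₀, ← Finset.sum_erase_add _ _ hjt]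
    congr 1
    exact Finset.sum_congr rfl fun i hi => hw i (hd i hi)
  have key₂ : ∀ t ⊆ s \ J.erase j₀, j₀ ∉ t → ∑ i ∈ t, w i = ∑ i ∈ t, v i := by
    intro t ht hjt
    refine Finset.sum_congr rfl fun i hi => hw i fun hiJ => ?_
    exact (Finset.mem_sdiff.1 (ht hi)).2 (Finset.mem_erase.2 ⟨fun e => hjt (e ▸ hi), hiJ⟩)
  have hj' : j₀ ∈ s \ J.erase j₀ := by simp [hJ hj]
  refine ⟨?_, fun t ht hn => ?_⟩
  · rw [key₁ _ subset_rfl hj', ← h.1]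
    congr 1
    ext i
    by_cases hi : i = j₀
    · subst hi; simp [hj, hJ hj]
    · by_cases hiJ : i ∈ J
      · simp [hiJ, hJ hiJ]
      · simp [hiJ]
  · by_cases hjt : j₀ ∈ t
    · rw [key₁ _ ht.1 hjt]
      refine h.2 _ ⟨Finset.union_subset (ht.1.trans Finset.sdiff_subset) hJ, fun hle => ?_⟩
        (hn.mono Finset.subset_union_left)
      obtain ⟨i, hi, hit⟩ := Finset.exists_of_ssubset ht
      obtain ⟨his, hiJ⟩ := Finset.mem_sdiff.1 hi
      rcases Finset.mem_union.1 (hle his) with h1 | h1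
      · exact hit h1
      · exact hiJ (Finset.mem_erase.2 ⟨fun e => hit (e ▸ hjt), h1⟩)
    · rw [key₂ _ ht.1 hjt]
      refine h.2 _ ⟨ht.1.trans Finset.sdiff_subset, fun hle => hjt (hle (hJ hj))⟩ hn

end MinimalRelation

section UnitEquation

variable {ι δ K : Type*} [Field K]

/-- The normalised nondegenerate solutions of height at most `N` of the unit equation
`∑ i ∈ s, f i * u (a i) = 0`, for nonzero coefficients `f`. -/
def unitSolutions (u : AddChar (δ → ℤ) K) (s : Finset ι) (i₀ : ι) (f : ι → K) (N : ℕ) :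
    Set (ι → δ → ℤ) :=
  {a | i₀ ∈ s ∧ (∀ i ∈ s, f i ≠ 0) ∧ (∀ i ∉ s, a i = 0) ∧ a i₀ = 0 ∧ (∀ i j, |a i j| ≤ N) ∧
    IsMinimalRelation s fun i => f i * u (a i)}

theorem AddChar.apply_ne_zero {G : Type*} [AddCommGroup G] (u : AddChar G K) (a : G) : u a ≠ 0 :=
  fun h => one_ne_zero (α := K) <| by
    rw [← u.map_zero_eq_one, ← add_neg_cancel a, u.map_add_eq_mul, h, zero_mul]

variable {p : ℕ} [Fact p.Prime]

theorem unitSolutions_ramified_subset [DecidableEq ι] (u : AddChar (δ → ℤ) K) (φ : K →+ K)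
    (hφ : ∀ x y, φ (y ^ p * x) = y ^ p * φ x) (hker : ∀ x, φ x = 0 ↔ ∃ y, x = y ^ p)
    (s : Finset ι) (i₀ : ι) (f : ι → K) (N : ℕ) :
    ∃ F : (ι → δ → ZMod p) → ι → K,
      {a ∈ unitSolutions u s i₀ f N | ∃ i ∈ s, φ (f i / f i₀ * u (a i)) ≠ 0} ⊆
        ⋃ q : (ι → δ → ZMod p) × Finset ι × ι,
          ⋃ b ∈ {b ∈ unitSolutions u q.2.1 q.2.2 (F q.1) (2 * N) |
              q.2.1.card < s.card ∧ (s \ q.2.1.erase q.2.2).card < s.card},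
            (fun c i => if i ∈ q.2.1 then c q.2.2 + b i else c i) ''
              unitSolutions u (s \ q.2.1.erase q.2.2) i₀
                (Function.update f q.2.2 (∑ i ∈ q.2.1, f i * u (b i))) N := by
  classical
  have hp : p.Prime := Fact.out
  let e : (ι → δ → ZMod p) → ι → δ → ℤ := fun ε i j => ((ε i j).val : ℤ)
  refine ⟨fun ε i => φ (f i / f i₀ * u (e ε i)) / u (e ε i), ?_⟩
  rintro a ⟨⟨hi₀, hf, haoff, habase, hN, hrel⟩, i₁, hi₁, hφ₁⟩
  have hfi₀ := hf i₀ hi₀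
  let ε : ι → δ → ZMod p := fun i j => (a i j : ZMod p)
  let F : ι → K := fun i => φ (f i / f i₀ * u (e ε i)) / u (e ε i)
  have hFu : ∀ i, φ (f i / f i₀ * u (a i)) = F i * u (a i) := fun i => by
    have hdvd : ∀ j, (p : ℤ) ∣ a i j - e ε i j := fun j => by
      rw [← ZMod.intCast_zmod_eq_zero_iff_dvd]
      simp [e, ε]
    choose b hb using hdvd
    have h1 : a i = p • b + e ε i := by
      funext j
      rw [Pi.add_apply, Pi.smul_apply, nsmul_eq_mul, ← hb]
      ring
    have h2 := u.apply_ne_zero (e ε i)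
    rw [h1, u.map_add_eq_mul, u.map_nsmul_eq_pow, mul_left_comm, hφ]
    simp only [F]
    field_simp
  have hone : φ 1 = 0 := (hker 1).2 ⟨1, (one_pow p).symm⟩
  have hF₀ : F i₀ = 0 := by
    have h1 := hFu i₀
    rw [habase, u.map_zero_eq_one, mul_one, mul_one, div_self hfi₀, hone] at h1
    exact h1.symm
  let I := s.filter fun i => F i ≠ 0
  have hI : I.Nonempty := by
    refine ⟨i₁, Finset.mem_filter.2 ⟨hi₁, fun h => hφ₁ ?_⟩⟩
    rw [hFu, h, zero_mul]
  have hIsum : ∑ i ∈ I, F i * u (a i) = 0 := by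
    have h1 : ∑ i ∈ I, F i * u (a i) = ∑ i ∈ s, F i * u (a i) := by
      refine Finset.sum_subset (Finset.filter_subset _ _) fun i hi hiI => ?_
      have : F i = 0 := by
        by_contra h
        exact hiI (Finset.mem_filter.2 ⟨hi, h⟩)
      rw [this, zero_mul]
    rw [h1, Finset.sum_congr rfl fun i _ => (hFu i).symm, ← map_sum]
    have h2 : ∑ i ∈ s, f i / f i₀ * u (a i) = (f i₀)⁻¹ * ∑ i ∈ s, f i * u (a i) := by
      rw [Finset.mul_sum]
      exact Finset.sum_congr rfl fun i _ => by ring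
    rw [h2, hrel.1, mul_zero, map_zero]
  obtain ⟨J, hJI, ⟨j₀, hj₀⟩, hJ⟩ := exists_isMinimalRelation _ I hI hIsum
  have hJs : J ⊆ s := hJI.trans (Finset.filter_subset _ _)
  have hJF : ∀ i ∈ J, F i ≠ 0 := fun i hi => (Finset.mem_filter.1 (hJI hi)).2
  have hi₀J : i₀ ∉ J := fun h => hJF i₀ h hF₀
  have hJss : J ⊂ s := ⟨hJs, fun h => hi₀J (h hi₀)⟩
  obtain ⟨j₁, hj₁, hne⟩ : ∃ j₁ ∈ J, j₁ ≠ j₀ := by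
    by_contra! h
    have h1 : J = {j₀} := Finset.eq_singleton_iff_unique_mem.2 ⟨hj₀, h⟩
    have h2 := hJ.1
    rw [h1, Finset.sum_singleton] at h2
    exact mul_ne_zero (hJF j₀ hj₀) (u.apply_ne_zero _) h2
  let b : ι → δ → ℤ := fun i => if i ∈ J then a i - a j₀ else 0
  let c : ι → δ → ℤ := fun i => if i ∈ J.erase j₀ then 0 else a i
  have hb : ∀ i ∈ J, u (b i) = (u (a j₀))⁻¹ * u (a i) := fun i hi => by
    have h1 := u.apply_ne_zero (a j₀)
    simp only [b, if_pos hi]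
    rw [eq_inv_mul_iff_mul_eq₀ h1, ← u.map_add_eq_mul, add_sub_cancel]
  have hc₀ : c j₀ = a j₀ := by simp [c]
  have hG : ∑ i ∈ J, f i * u (b i) = (u (a j₀))⁻¹ * ∑ i ∈ J, f i * u (a i) := by
    rw [Finset.mul_sum]
    refine Finset.sum_congr rfl fun i hi => ?_
    rw [hb i hi]
    ring
  simp only [Set.mem_iUnion]
  refine ⟨(ε, J, j₀), b, ⟨⟨hj₀, hJF, fun i hi => by simp [b, hi], by simp [b, hj₀], fun i j => ?_,
    ?_⟩, Finset.card_lt_card hJss, Finset.card_lt_card ⟨Finset.sdiff_subset, fun h => ?_⟩⟩, c,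
    ⟨?_, fun i hi => ?_, fun i hi => ?_, ?_, fun i j => ?_, ?_⟩, ?_⟩
  · by_cases hi : i ∈ J
    · simp only [b, if_pos hi, Pi.sub_apply]
      have h1 := abs_le.1 (hN i j)
      have h2 := abs_le.1 (hN j₀ j)
      rw [abs_le]
      push_cast
      constructor <;> linarith
    · simp [b, hi]
  · refine hJ.const_mul (inv_ne_zero (u.apply_ne_zero (a j₀))) fun i hi => ?_
    change F i * u (b i) = _
    rw [hb i hi]
    ring
  · exact (Finset.mem_sdiff.1 (h (hJs hj₁))).2 (Finset.mem_erase.2 ⟨hne, hj₁⟩)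
  · simp [hi₀, hi₀J]
  · by_cases hij : i = j₀
    · subst hij
      simp only [Function.update_self]
      rw [hG]
      exact mul_ne_zero (inv_ne_zero (u.apply_ne_zero _)) (hrel.2 J hJss ⟨_, hj₀⟩)
    · simp only [Function.update_of_ne hij]
      exact hf i (Finset.mem_sdiff.1 hi).1
  · by_cases hiJ : i ∈ J.erase j₀
    · simp only [c, if_pos hiJ]
    · simp only [c, if_neg hiJ]
      exact haoff i fun h => hi (Finset.mem_sdiff.2 ⟨h, hiJ⟩)
  · simp [c, habase]
  · by_cases hiJ : i ∈ J.erase j₀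
    · simp only [c, if_pos hiJ]
      simp
    · simp only [c, if_neg hiJ]
      exact hN i j
  · refine hrel.merge hJs hj₀ (fun i hi => ?_) ?_
    · have h1 : i ≠ j₀ := fun h => hi (h ▸ hj₀)
      simp [Function.update_of_ne h1, c, hi]
    · simp only [Function.update_self]
      rw [hG, hc₀]
      have h1 := u.apply_ne_zero (a j₀)
      field_simp
  · funext i
    by_cases hi : i ∈ J
    · simp [hi, hc₀, b]
    · simp [hi, c]

variable [CharP K p]

theorem exists_unitSolutions_descent (u : AddChar (δ → ℤ) K)
    (hu : ∀ a y, u a = y ^ p → ∀ j, (p : ℤ) ∣ a j) (φ : K →+ K)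
    (hker : ∀ x, φ x = 0 ↔ ∃ y, x = y ^ p)
    (s : Finset ι) (i₀ : ι) (f : ι → K) (N : ℕ) :
    ∃ (e : ι → δ → ℤ) (g : ι → K),
      {a ∈ unitSolutions u s i₀ f N | ∀ i ∈ s, φ (f i / f i₀ * u (a i)) = 0} ⊆
        (fun b i => e i + p • b i) '' unitSolutions u s i₀ g ((N + p - 1) / p) := by
  classical
  have hp : p.Prime := Fact.out
  have hp0 : (0 : ℤ) < p := by exact_mod_cast hp.pos
  rcases Set.eq_empty_or_nonempty
    {a ∈ unitSolutions u s i₀ f N | ∀ i ∈ s, φ (f i / f i₀ * u (a i)) = 0} with h | ⟨a₀, ha₀, hφ₀⟩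
  · exact ⟨0, 0, by rw [h]; exact Set.empty_subset _⟩
  obtain ⟨hi₀, hf, hoff, hbase, -, -⟩ := ha₀
  have hfi₀ := hf i₀ hi₀
  let e : ι → δ → ℤ := fun i j => a₀ i j % p
  have he : ∀ i, a₀ i = e i + p • fun j => a₀ i j / p := fun i => by
    funext j
    rw [Pi.add_apply, Pi.smul_apply, nsmul_eq_mul]
    exact (Int.emod_add_mul_ediv _ _).symm
  have hg : ∀ i ∈ s, ∃ y, f i / f i₀ * u (e i) = y ^ p := fun i hi => by
    obtain ⟨y, hy⟩ := (hker _).1 (hφ₀ i hi)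
    refine ⟨y / u fun j => a₀ i j / p, ?_⟩
    have h1 := u.apply_ne_zero fun j => a₀ i j / p
    rw [he i, u.map_add_eq_mul, u.map_nsmul_eq_pow] at hy
    rw [div_pow, ← hy]
    field_simp
  choose! g hg using hg
  refine ⟨e, g, ?_⟩
  rintro a ⟨⟨-, -, haoff, habase, hN, hrel⟩, hφ⟩
  have hdvd : ∀ i ∈ s, ∀ j, (p : ℤ) ∣ a i j - e i j := fun i hi j => by
    obtain ⟨y, hy⟩ := (hker _).1 (hφ i hi)
    have h2 := hg i hi
    refine hu (a i - e i) (y / g i) ?_ j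
    have h3 : f i / f i₀ ≠ 0 := div_ne_zero (hf i hi) hfi₀
    have h4 := u.apply_ne_zero (e i)
    rw [div_pow, ← hy, ← h2, mul_div_mul_left _ _ h3, eq_div_iff h4, ← u.map_add_eq_mul,
      sub_add_cancel]
  have he0 : ∀ i, a₀ i = 0 → e i = 0 := fun i h => by
    funext j
    simp [e, h]
  have hdvd' : ∀ i j, (p : ℤ) ∣ a i j - e i j := fun i j => by
    by_cases hi : i ∈ s
    · exact hdvd i hi j
    · simp [haoff i hi, he0 i (hoff i hi)]
  have hb : ∀ i, a i = e i + p • fun j => (a i j - e i j) / p := fun i => by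
    funext j
    rw [Pi.add_apply, Pi.smul_apply, nsmul_eq_mul, Int.mul_ediv_cancel' (hdvd' i j)]
    ring
  refine ⟨fun i j => (a i j - e i j) / p, ⟨hi₀, fun i hi h0 => ?_, fun i hi => ?_, ?_, fun i j => ?_,
    ?_⟩, funext fun i => (hb i).symm⟩
  · have h1 := hg i hi
    rw [h0, zero_pow hp.ne_zero] at h1
    exact mul_ne_zero (div_ne_zero (hf i hi) hfi₀) (u.apply_ne_zero _) h1
  · funext j
    simp [haoff i hi, he0 i (hoff i hi)]
  · funext j
    simp [habase, he0 i₀ hbase]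
  · obtain ⟨b, hb⟩ := hdvd' i j
    have h1 : 0 ≤ e i j := Int.emod_nonneg _ hp0.ne'
    have h2 : e i j < p := Int.emod_lt_of_pos _ hp0
    have h3 := abs_le.1 (hN i j)
    change |(a i j - e i j) / (p : ℤ)| ≤ _
    rw [hb, Int.mul_ediv_cancel_left _ hp0.ne']
    have h4 : (((N + p - 1) / p : ℕ) : ℤ) = ((N : ℤ) + p - 1) / p := by
      rw [Int.natCast_div]
      congr 1
      have := hp.pos
      omega
    rw [h4, abs_le]
    have h5 : b ≤ ((N : ℤ) + p - 1) / p := by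
      rw [Int.le_ediv_iff_mul_le hp0]
      linarith
    have h6 : -b ≤ ((N : ℤ) + p - 1) / p := by
      rw [Int.le_ediv_iff_mul_le hp0]
      linarith
    constructor <;> linarith
  · refine (hrel.const_mul (inv_ne_zero hfi₀) fun i _ => rfl).of_pow (p := p) fun i hi => ?_
    rw [mul_pow, ← hg i hi, ← u.map_nsmul_eq_pow]
    nth_rewrite 1 [hb i]
    rw [u.map_add_eq_mul]
    ring

theorem exists_hasCover_unitSolutions [Fintype ι] [Fintype δ] (u : AddChar (δ → ℤ) K)
    (hu : ∀ a y, u a = y ^ p → ∀ j, (p : ℤ) ∣ a j) (φ : K →+ K)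
    (hφ : ∀ x y, φ (y ^ p * x) = y ^ p * φ x) (hker : ∀ x, φ x = 0 ↔ ∃ y, x = y ^ p) (n : ℕ) :
    ∃ C m : ℕ, ∀ s : Finset ι, s.card ≤ n → ∀ i₀ f k,
      HasCover (unitSolutions u s i₀ f (2 ^ k + 1)) (C * (k + 1) ^ m) := by
  classical
  have hp : p.Prime := Fact.out
  induction n with
  | zero =>
    refine ⟨0, 0, fun s hs i₀ f k => ?_⟩
    have hs' : s = ∅ := Finset.card_eq_zero.1 (Nat.le_zero.1 hs)
    refine (HasCover.empty _).mono ?_ le_rfl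
    rintro a ⟨h, -⟩
    simp [hs'] at h
  | succ n ih =>
    obtain ⟨C, m, hC⟩ := ih
    obtain ⟨B, hB⟩ := exists_hasCover_abs_le (ι := ι) (δ := δ) 2
    let A := Fintype.card ((ι → δ → ZMod p) × Finset ι × ι)
    let C' := A * (C * 3 ^ m * C)
    refine ⟨B + C', 2 * m + 1, fun s hs i₀ f k => ?_⟩
    have ramified : ∀ f k, HasCover {a ∈ unitSolutions u s i₀ f (2 ^ k + 1) |
        ∃ i ∈ s, φ (f i / f i₀ * u (a i)) ≠ 0} (C' * (k + 1) ^ (2 * m)) := by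
      intro f k
      obtain ⟨F, hF⟩ := unitSolutions_ramified_subset u φ hφ hker s i₀ f (2 ^ k + 1)
      refine HasCover.mono (HasCover.iUnion (n := C * 3 ^ m * C * (k + 1) ^ (2 * m)) fun q => ?_) hF
        (mul_assoc _ _ _).symm.le
      by_cases hq : q.2.1.card < s.card ∧ (s \ q.2.1.erase q.2.2).card < s.card
      · have h1 := hC q.2.1 (by omega) q.2.2 (F q.1) (k + 2)
        have h2 := fun g => hC (s \ q.2.1.erase q.2.2) (by omega) i₀ g k
        refine (HasCover.biUnion (h1.mono (T := {b ∈ unitSolutions u q.2.1 q.2.2 (F q.1)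
          (2 * (2 ^ k + 1)) | q.2.1.card < s.card ∧ (s \ q.2.1.erase q.2.2).card < s.card})
          ?_ le_rfl) fun b => (h2 _).image _).mono subset_rfl ?_
        · rintro b ⟨⟨g1, g2, g3, g4, g5, g6⟩, -⟩
          refine ⟨g1, g2, g3, g4, fun i j => (g5 i j).trans ?_, g6⟩
          have : 2 * (2 ^ k + 1) ≤ 2 ^ (k + 2) + 1 := by
            have := Nat.one_le_two_pow (n := k)
            rw [pow_add]
            omega
          exact_mod_cast this
        · calc C * (k + 2 + 1) ^ m * (C * (k + 1) ^ m)
              ≤ C * (3 * (k + 1)) ^ m * (C * (k + 1) ^ m) := by gcongr; omega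
            _ = C * 3 ^ m * C * (k + 1) ^ (2 * m) := by rw [mul_pow, two_mul, pow_add]; ring
      · refine (HasCover.empty _).mono ?_ le_rfl
        intro a ha
        simp only [Set.mem_iUnion] at ha
        obtain ⟨b, hb, -⟩ := ha
        exact hq hb.2
    induction k generalizing f with
    | zero =>
      refine hB.mono (fun a ha => ?_) (by simp)
      simpa using ha.2.2.2.2.1
    | succ k ihk =>
      obtain ⟨e, g, hg⟩ := exists_unitSolutions_descent u hu φ hker s i₀ f (2 ^ (k + 1) + 1)
      have hle : (2 ^ (k + 1) + 1 + p - 1) / p ≤ 2 ^ k + 1 := by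
        rw [Nat.div_le_iff_le_mul_add_pred hp.pos]
        have h2 := hp.two_le
        have h3 := Nat.mul_le_mul_right (2 ^ k) h2
        rw [pow_succ, mul_add]
        omega
      have h1 := ((ihk g).mono (T := unitSolutions u s i₀ g ((2 ^ (k + 1) + 1 + p - 1) / p))
        (fun a ⟨g1, g2, g3, g4, g5, g6⟩ =>
          ⟨g1, g2, g3, g4, fun i j => (g5 i j).trans (by exact_mod_cast hle), g6⟩) le_rfl).image
        (fun b i => e i + p • b i)
      refine ((h1.mono hg le_rfl).union (ramified f (k + 1))).mono (fun a ha => ?_) ?_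
      · by_cases h : ∀ i ∈ s, φ (f i / f i₀ * u (a i)) = 0
        · exact Or.inl ⟨ha, h⟩
        · push Not at h
          exact Or.inr ⟨ha, h⟩
      · calc (B + C') * (k + 1) ^ (2 * m + 1) + C' * (k + 1 + 1) ^ (2 * m)
            ≤ (B + C') * ((k + 1 + 1) ^ (2 * m) * (k + 1)) + (B + C') * (k + 1 + 1) ^ (2 * m) := by
              rw [pow_succ]
              gcongr <;> omega
          _ = (B + C') * (k + 1 + 1) ^ (2 * m + 1) := by ring

/-- The vanishing sums of `card s` terms `c i * u (σ i)` with distinct exponents `σ i ∈ D`. -/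
def vanishingSums (u : AddChar (δ → ℤ) K) (c : ι → K) (s : Finset ι) (D : Finset (δ → ℤ)) :
    Set (ι → δ → ℤ) :=
  {σ | (∀ i ∉ s, σ i = 0) ∧ (∀ i ∈ s, σ i ∈ D) ∧ Set.InjOn σ s ∧ ∑ i ∈ s, c i * u (σ i) = 0}

theorem eq_zero_of_apply_pow_eq (u : AddChar (δ → ℤ) K)
    (hu : ∀ a y, u a = y ^ p → ∀ j, (p : ℤ) ∣ a j) {x : K} (hx : x ^ p = x) {a : δ → ℤ}
    (ha : u a = x) : a = 0 := by
  have hp : p.Prime := Fact.out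
  have key : ∀ n : ℕ, ∀ a, u a = x → ∀ j, (p : ℤ) ^ n ∣ a j := by
    intro n
    induction n with
    | zero => simp
    | succ n ih =>
      intro a ha j
      choose b hb using hu a x (ha.trans hx.symm)
      have h1 : a = p • b := by
        funext j
        rw [Pi.smul_apply, nsmul_eq_mul, hb]
      rw [h1, u.map_nsmul_eq_pow] at ha
      have h2 : u b = x := frobenius_inj K p (by simpa only [frobenius_def] using ha.trans hx.symm)
      rw [hb, pow_succ, mul_comm]
      exact mul_dvd_mul_left _ (ih b h2 j)
  funext j
  refine Int.eq_zero_of_abs_lt_dvd (key (a j).natAbs a ha j) ?_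
  rw [Int.abs_eq_natAbs]
  exact_mod_cast Nat.lt_pow_self hp.one_lt

theorem three_le_card_of_sum_eq_zero [DecidableEq ι] (u : AddChar (δ → ℤ) K)
    (hu : ∀ a y, u a = y ^ p → ∀ j, (p : ℤ) ∣ a j) {c : ι → K} (hc : ∀ i, c i ≠ 0)
    (hcp : ∀ i, c i ^ p = c i) {t : Finset ι} (ht : t.Nonempty) {σ : ι → δ → ℤ}
    (hσ : Set.InjOn σ t) (h : ∑ i ∈ t, c i * u (σ i) = 0) : 3 ≤ t.card := by
  by_contra! hlt
  have hpos := ht.card_pos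
  obtain h1 | h2 : t.card = 1 ∨ t.card = 2 := by omega
  · obtain ⟨i, rfl⟩ := Finset.card_eq_one.1 h1
    rw [Finset.sum_singleton] at h
    exact mul_ne_zero (hc i) (u.apply_ne_zero _) h
  · obtain ⟨i, j, hij, rfl⟩ := Finset.card_eq_two.1 h2
    rw [Finset.sum_pair hij] at h
    have h3 : u (σ i - σ j) = -c j / c i := by
      have h4 : u (σ i) = u (σ i - σ j) * u (σ j) := by rw [← u.map_add_eq_mul, sub_add_cancel]
      rw [eq_div_iff (hc i)]
      apply mul_right_cancel₀ (u.apply_ne_zero (σ j))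
      rw [h4] at h
      linear_combination h
    have h5 : (-c j / c i) ^ p = -c j / c i := by
      rw [← frobenius_def p, map_div₀, map_neg, frobenius_def, frobenius_def, hcp, hcp]
    have h6 := eq_zero_of_apply_pow_eq u hu h5 h3
    exact hij (hσ (by simp) (by simp) (sub_eq_zero.1 h6))

theorem exists_hasCover_vanishingSums [Fintype ι] [Fintype δ] (u : AddChar (δ → ℤ) K)
    (hu : ∀ a y, u a = y ^ p → ∀ j, (p : ℤ) ∣ a j) (φ : K →+ K)
    (hφ : ∀ x y, φ (y ^ p * x) = y ^ p * φ x) (hker : ∀ x, φ x = 0 ↔ ∃ y, x = y ^ p) (n : ℕ) :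
    ∃ C m : ℕ, ∀ s : Finset ι, s.card ≤ n → ∀ c : ι → K, (∀ i, c i ≠ 0) → (∀ i, c i ^ p = c i) →
      ∀ (D : Finset (δ → ℤ)) (k : ℕ), D.Nonempty →
        (∀ a ∈ D, ∀ b ∈ D, ∀ j, |a j - b j| ≤ 2 ^ k + 1) →
          HasCover (vanishingSums u c s D) (C * D.card ^ (s.card / 3) * (k + 1) ^ m) := by
  classical
  induction n with
  | zero =>
    refine ⟨1, 0, fun s hs c _ _ D k _ _ => ⟨{0}, fun σ hσ => ?_, ?_⟩⟩
    · have hs' : s = ∅ := Finset.card_eq_zero.1 (Nat.le_zero.1 hs)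
      subst hs'
      exact Finset.mem_coe.2 (Finset.mem_singleton.2 (funext fun i => hσ.1 i (by simp)))
    · simp [Nat.le_zero.1 hs]
  | succ n ih =>
    obtain ⟨C₁, m₁, h₁⟩ := ih
    obtain ⟨C₂, m₂, h₂⟩ := exists_hasCover_unitSolutions (ι := ι) u hu φ hφ hker (n + 1)
    let A := Fintype.card (Finset ι × ι)
    refine ⟨C₁ + A * (C₁ * C₂), m₁ + m₂, fun s hs c hc hcp D k hD hdiam => ?_⟩
    have hDpos := hD.card_pos
    by_cases hsn : s.card ≤ n
    · refine (h₁ s hsn c hc hcp D k hD hdiam).mono subset_rfl ?_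
      gcongr <;> omega
    have hsne : s.Nonempty := Finset.card_pos.1 (by omega)
    have hsub : vanishingSums u c s D ⊆ ⋃ q : Finset ι × ι,
        ⋃ τ ∈ {τ ∈ vanishingSums u c (s \ q.1) D | q.1 ⊆ s ∧ 3 ≤ q.1.card},
          ⋃ b ∈ unitSolutions u q.1 q.2 c (2 ^ k + 1),
            (fun x i => if i ∈ q.1 then x + b i else τ i) '' (D : Set (δ → ℤ)) := by
      rintro σ ⟨hoff, hmem, hinj, hsum⟩
      obtain ⟨t, hts, ⟨i₀, hi₀⟩, ht⟩ := exists_isMinimalRelation _ s hsne hsum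
      have h3 := three_le_card_of_sum_eq_zero u hu hc hcp ⟨i₀, hi₀⟩
        (hinj.mono (Finset.coe_subset.2 hts)) ht.1
      simp only [Set.mem_iUnion]
      refine ⟨(t, i₀), fun i => if i ∈ t then 0 else σ i,
        ⟨⟨fun i hi => ?_, fun i hi => ?_, ?_, ?_⟩, hts, h3⟩,
        fun i => if i ∈ t then σ i - σ i₀ else 0,
        ⟨hi₀, fun i _ => hc i, fun i hi => by simp [hi], by simp, fun i j => ?_, ?_⟩,
        σ i₀, hmem i₀ (hts hi₀), funext fun i => ?_⟩
      · by_cases hit : i ∈ t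
        · simp [hit]
        · simp only [if_neg hit]
          exact hoff i fun h => hi (Finset.mem_sdiff.2 ⟨h, hit⟩)
      · obtain ⟨his, hit⟩ := Finset.mem_sdiff.1 hi
        simpa [hit] using hmem i his
      · intro i hi j hj hij
        obtain ⟨his, hit⟩ := Finset.mem_sdiff.1 (Finset.mem_coe.1 hi)
        obtain ⟨hjs, hjt⟩ := Finset.mem_sdiff.1 (Finset.mem_coe.1 hj)
        simp only [if_neg hit, if_neg hjt] at hij
        exact hinj his hjs hij
      · have h4 := Finset.sum_sdiff (f := fun i => c i * u (σ i)) hts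
        rw [ht.1, add_zero, hsum] at h4
        rw [← h4]
        exact Finset.sum_congr rfl fun i hi => by
          simp only [if_neg (Finset.mem_sdiff.1 hi).2]
      · by_cases hit : i ∈ t
        · simp only [if_pos hit, Pi.sub_apply]
          exact_mod_cast hdiam _ (hmem i (hts hit)) _ (hmem i₀ (hts hi₀)) j
        · simp only [if_neg hit, Pi.zero_apply, abs_zero]
          positivity
      · refine ht.const_mul (inv_ne_zero (u.apply_ne_zero (σ i₀))) fun i hi => ?_
        have h4 : u (σ i) = u (σ i - σ i₀) * u (σ i₀) := by
          rw [← u.map_add_eq_mul, sub_add_cancel]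
        have h5 := u.apply_ne_zero (σ i₀)
        simp only [if_pos hi]
        rw [h4]
        field_simp
      · by_cases hit : i ∈ t <;> simp [hit]
    refine HasCover.mono (HasCover.iUnion
      (n := C₁ * C₂ * (D.card ^ (s.card / 3) * (k + 1) ^ (m₁ + m₂))) fun q => ?_) hsub ?_
    · by_cases hq : q.1 ⊆ s ∧ 3 ≤ q.1.card
      · have hcard := Finset.card_sdiff_add_card_eq_card hq.1
        have g₁ := (h₁ (s \ q.1) (by omega) c hc hcp D k hD hdiam).mono
          (T := {τ ∈ vanishingSums u c (s \ q.1) D | q.1 ⊆ s ∧ 3 ≤ q.1.card})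
          (fun τ hτ => hτ.1) le_rfl
        have g₂ := h₂ q.1 (by omega) q.2 c k
        have g₃ : HasCover (D : Set (δ → ℤ)) D.card := ⟨D, subset_rfl, le_rfl⟩
        refine (g₁.biUnion fun τ => g₂.biUnion fun b => g₃.image _).mono subset_rfl ?_
        have h4 : D.card ^ ((s \ q.1).card / 3) * D.card ≤ D.card ^ (s.card / 3) := by
          rw [← pow_succ]
          exact Nat.pow_le_pow_right hDpos (by omega)
        calc C₁ * D.card ^ ((s \ q.1).card / 3) * (k + 1) ^ m₁ * (C₂ * (k + 1) ^ m₂ * D.card)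
            = C₁ * C₂ * ((D.card ^ ((s \ q.1).card / 3) * D.card) * (k + 1) ^ (m₁ + m₂)) := by
              rw [pow_add]; ring
          _ ≤ _ := by gcongr
      · refine (HasCover.empty _).mono ?_ le_rfl
        intro a ha
        simp only [Set.mem_iUnion] at ha
        obtain ⟨τ, hτ, -⟩ := ha
        exact hq hτ.2
    · calc Fintype.card (Finset ι × ι) * (C₁ * C₂ * (D.card ^ (s.card / 3) * (k + 1) ^ (m₁ + m₂)))
          = A * (C₁ * C₂) * D.card ^ (s.card / 3) * (k + 1) ^ (m₁ + m₂) := by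
            simp only [A]; ring
        _ ≤ _ := by gcongr; omega

end UnitEquation

/-- The inclusion of exponent vectors `ℕ^δ` into `ℤ^δ`. -/
def exponentEmbedding (δ : Type*) : (δ →₀ ℕ) ↪ (δ → ℤ) where
  toFun a j := a j
  inj' _ _ h := Finsupp.ext fun j => Int.ofNat_inj.1 (congrFun h j)

open MvPolynomial in
/-- Every special polynomial with `r` terms comes from a vanishing sum of `r` terms. -/
theorem setOf_special_subset_image {p : ℕ} [Fact p.Prime] {δ : Type*} [Fintype δ]
    (R : δ → Polynomial (ZMod p)) (hR : ∀ j, R j ≠ 0) (r : ℕ)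
    (D : Finset (δ →₀ ℕ)) :
    {Γ : MvPolynomial δ (ZMod p) | aeval R Γ = 0 ∧ Γ.support ⊆ D ∧ Γ.support.card = r} ⊆
      ⋃ c : Fin r → (ZMod p)ˣ,
        (fun σ : Fin r → δ → ℤ => ∑ i, monomial
            (Finsupp.equivFunOnFinite.symm fun j => (σ i j).toNat) (c i : ZMod p)) ''
          vanishingSums (prodZPow R hR)
            (fun i => algebraMap (ZMod p) (FractionRing (Polynomial (ZMod p))) (c i)) Finset.univ
            (D.map (exponentEmbedding δ)) := by
  rintro Γ ⟨hΓ, hD, hr⟩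
  let e := Γ.support.equivFinOfCardEq hr
  have hsum : ∑ i : Fin r, monomial (e.symm i).1 (Γ.coeff (e.symm i).1) = Γ := by
    rw [Equiv.sum_comp e.symm fun v => monomial v.1 (Γ.coeff v.1),
      Finset.sum_coe_sort Γ.support fun v => monomial v (Γ.coeff v)]
    exact support_sum_monomial_coeff Γ
  refine Set.mem_iUnion.2 ⟨fun i => Units.mk0 (Γ.coeff (e.symm i).1)
    (mem_support_iff.1 (e.symm i).2), fun i j => ((e.symm i).1 j : ℤ),
    ⟨by simp, fun i _ => ?_, fun i _ i' _ h => ?_, ?_⟩, ?_⟩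
  · exact Finset.mem_map.2 ⟨_, hD (e.symm i).2, rfl⟩
  · exact e.symm.injective (Subtype.ext (Finsupp.ext fun j => Int.ofNat_inj.1 (congrFun h j)))
  · rw [← hsum, map_sum] at hΓ
    have h1 := congrArg (algebraMap _ (FractionRing (Polynomial (ZMod p)))) hΓ
    rw [map_sum, map_zero] at h1
    rw [← h1]
    refine Finset.sum_congr rfl fun i _ => ?_
    rw [aeval_monomial, map_mul, prodZPow_natCast, Finsupp.prod_fintype _ _ (by simp),
      ← IsScalarTower.algebraMap_apply]
    rfl
  · simpa using hsum

theorem abs_sub_le_expDiam {d : ℕ} {D : Finset (Fin d →₀ ℕ)} {a b : Fin d →₀ ℕ} (ha : a ∈ D)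
    (hb : b ∈ D) (j : Fin d) : |(a j : ℤ) - b j| ≤ expDiam D := by
  rw [Int.abs_eq_natAbs]
  have h : ((a j : ℤ) - b j).natAbs ≤ expDiam D :=
    (Finset.le_sup (f := fun i : Fin d => ((a i : ℤ) - (b i : ℤ)).natAbs) (Finset.mem_univ j)).trans
      ((Finset.le_sup (f := fun b : Fin d →₀ ℕ =>
        Finset.univ.sup fun i : Fin d => ((a i : ℤ) - (b i : ℤ)).natAbs) hb).trans
      (Finset.le_sup (f := fun a : Fin d →₀ ℕ => D.sup fun b : Fin d →₀ ℕ =>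
        Finset.univ.sup fun i : Fin d => ((a i : ℤ) - (b i : ℤ)).natAbs) ha))
  exact_mod_cast h

theorem natLog_two_add_two_le (n : ℕ) :
    ((Nat.log 2 (1 + n) + 1 + 1 : ℕ) : ℝ) ≤ 2 * (1 + Real.log (1 + n)) := by
  have h1 : (Nat.log 2 (1 + n) : ℝ) ≤ Real.logb 2 (1 + n) := by
    have := Real.natLog_le_logb (1 + n) 2
    push_cast at this
    exact this
  have h2 : Real.logb 2 (1 + n) ≤ 2 * Real.log (1 + n) := by
    have h3 : 0 ≤ Real.log (1 + n) := Real.log_nonneg (by simp)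
    have h4 := Real.log_two_gt_d9
    rw [Real.logb, div_le_iff₀ (by linarith)]
    nlinarith
  push_cast
  linarith

theorem exists_ncard_special_le {p : ℕ} [Fact p.Prime] {d : ℕ} (R : Fin d → Polynomial (ZMod p))
    (hR : ∀ j, (R j).Monic ∧ Irreducible (R j)) (hinj : Function.Injective R) (r : ℕ) :
    ∃ C m : ℕ, ∀ (D : Finset (Fin d →₀ ℕ)) (k : ℕ), D.Nonempty → expDiam D ≤ 2 ^ k + 1 →
      {Γ : MvPolynomial (Fin d) (ZMod p) |
          MvPolynomial.aeval R Γ = 0 ∧ Γ.support ⊆ D ∧ Γ.support.card = r}.ncard ≤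
        C * D.card ^ (r / 3) * (k + 1) ^ m := by
  have : CharP (FractionRing (Polynomial (ZMod p))) p :=
    charP_of_injective_algebraMap (algebraMap (ZMod p) _).injective p
  obtain ⟨φ, hφ, hker⟩ := exists_addMonoidHom_ker_eq_pow p
  have hR₀ : ∀ j, R j ≠ 0 := fun j => (hR j).2.ne_zero
  obtain ⟨C, m, hC⟩ := exists_hasCover_vanishingSums (ι := Fin r) (prodZPow R hR₀)
    (dvd_of_prodZPow_eq_pow R hR hinj) φ hφ hker r
  refine ⟨Fintype.card (Fin r → (ZMod p)ˣ) * C, m, fun D k hD hk => ?_⟩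
  have hdiam : ∀ a ∈ D.map (exponentEmbedding (Fin d)), ∀ b ∈ D.map (exponentEmbedding (Fin d)),
      ∀ j, |a j - b j| ≤ 2 ^ k + 1 := by
    intro a ha b hb j
    obtain ⟨a', ha', rfl⟩ := Finset.mem_map.1 ha
    obtain ⟨b', hb', rfl⟩ := Finset.mem_map.1 hb
    exact (abs_sub_le_expDiam ha' hb' j).trans (by exact_mod_cast hk)
  have hcover : ∀ c : Fin r → (ZMod p)ˣ, HasCover (vanishingSums (prodZPow R hR₀)
      (fun i => algebraMap (ZMod p) (FractionRing (Polynomial (ZMod p))) (c i)) Finset.univ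
      (D.map (exponentEmbedding (Fin d)))) (C * D.card ^ (r / 3) * (k + 1) ^ m) := fun c => by
    have hc₀ : ∀ i, algebraMap (ZMod p) (FractionRing (Polynomial (ZMod p))) (c i) ≠ 0 :=
      fun i => (map_ne_zero _).2 (c i).ne_zero
    have hcp : ∀ i, algebraMap (ZMod p) (FractionRing (Polynomial (ZMod p))) (c i) ^ p =
        algebraMap (ZMod p) (FractionRing (Polynomial (ZMod p))) (c i) :=
      fun i => by rw [← map_pow, ZMod.pow_card]
    have h := hC Finset.univ (by simp) _ hc₀ hcp _ k (hD.map (f := exponentEmbedding _)) hdiam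
    rwa [Finset.card_map, Finset.card_univ, Fintype.card_fin] at h
  refine HasCover.ncard_le ((HasCover.iUnion fun c => (hcover c).image _).mono
    (setOf_special_subset_image R hR₀ r D) (le_of_eq ?_))
  ring

theorem stmt_7 (p : ℕ) [Fact p.Prime] (d : ℕ) (hd : 1 ≤ d)
    (R : Fin d → Polynomial (ZMod p))
    (hR : ∀ j, (R j).Monic ∧ Irreducible (R j))
    (hinj : Function.Injective R)
    (r : ℕ) (hr : 1 ≤ r) :
    ∃ K γ : ℝ, 0 < K ∧ 0 < γ ∧
      ∀ D : Finset (Fin d →₀ ℕ), D.Nonempty →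
        ({Γ : MvPolynomial (Fin d) (ZMod p) |
            MvPolynomial.aeval R Γ = 0 ∧ Γ.support ⊆ D ∧ Γ.support.card = r}.ncard : ℝ)
        ≤ K * (D.card : ℝ) ^ ((r : ℝ) / 3) *
            (1 + Real.log (1 + (expDiam D : ℝ))) ^ γ := by
  obtain ⟨C, m, hC⟩ := exists_ncard_special_le R hR hinj r
  refine ⟨C * 2 ^ m + 1, m + 1, by positivity, by positivity, fun D hD => ?_⟩
  set k := Nat.log 2 (1 + expDiam D) + 1 with hk
  have hdiam : expDiam D ≤ 2 ^ k + 1 := by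
    have := Nat.lt_pow_succ_log_self one_lt_two (1 + expDiam D)
    rw [hk]
    omega
  have hcount := hC D k hD hdiam
  have hD1 : (1 : ℝ) ≤ D.card := by exact_mod_cast hD.card_pos
  have hpow : (D.card : ℝ) ^ (r / 3) ≤ (D.card : ℝ) ^ ((r : ℝ) / 3) := by
    rw [← Real.rpow_natCast]
    refine Real.rpow_le_rpow_of_exponent_le hD1 ?_
    exact_mod_cast Nat.cast_div_le (m := r) (n := 3) (α := ℝ)
  have hL : 1 ≤ 1 + Real.log (1 + (expDiam D : ℝ)) := by
    have := Real.log_nonneg (x := 1 + (expDiam D : ℝ)) (by simp)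
    linarith
  have hklog := natLog_two_add_two_le (expDiam D)
  rw [← hk] at hklog
  set L := 1 + Real.log (1 + (expDiam D : ℝ))
  have hLpow : ((k + 1 : ℕ) : ℝ) ^ m ≤ 2 ^ m * L ^ ((m : ℝ) + 1) := by
    calc ((k + 1 : ℕ) : ℝ) ^ m ≤ (2 * L) ^ m := by gcongr
      _ = 2 ^ m * L ^ (m : ℝ) := by rw [mul_pow, Real.rpow_natCast]
      _ ≤ 2 ^ m * L ^ ((m : ℝ) + 1) := by
        gcongr
        linarith
  calc _ ≤ ((C * D.card ^ (r / 3) * (k + 1) ^ m : ℕ) : ℝ) := by exact_mod_cast hcount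
    _ = C * (D.card : ℝ) ^ (r / 3) * ((k + 1 : ℕ) : ℝ) ^ m := by push_cast; ring
    _ ≤ C * (D.card : ℝ) ^ ((r : ℝ) / 3) * (2 ^ m * L ^ ((m : ℝ) + 1)) := by gcongr
    _ = C * 2 ^ m * (D.card : ℝ) ^ ((r : ℝ) / 3) * L ^ ((m : ℝ) + 1) := by ring
    _ ≤ _ := by
      gcongr
      linarith
end

section
/- Let p be a prime, d ≥ 1, R_1, …, R_d ∈ 𝔽_p[x], and let Γ ∈ 𝔽_p[X_1, …, X_d] be a special R-polynomial. For α ∈ {0, …, p−1}^d define Γ̄_α ∈ 𝔽_p[X_1, …, X_d] by Γ̄_α := ∑_{b ∈ ℕ^d} coeff(Γ, p·b + α) · X^{p·b} (the α-homogeneous component of Γ with exponents shifted down by α). For β ∈ {0, …, p−1}^d define, in the multivariate polynomial ring 𝔽_p[x][X_1, …, X_d] over the coefficient ring 𝔽_p[x], A_β := ∑_{α ∈ {0,…,p−1}^d} D_{α+β} · Γ̄_α, where D_{α+β} ∈ 𝔽_p[x] is the formal derivative of ∏_{i=1}^d R_i^{α_i+β_i} (with exponents α_i + β_i added in ℕ),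 viewed as a constant coefficient, and Γ̄_α is viewed as having coefficients in 𝔽_p ⊆ 𝔽_p[x]. Then substituting X_i ↦ R_i in A_β (acting as the identity on the coefficient ring 𝔽_p[x]) yields 0; that is, A_β is again a special polynomial. -/
/-- The `α`-homogeneous component of `Γ` with exponents shifted down by `α`:
`Γ̄_α = ∑_{b ∈ ℕ^d} coeff(Γ, p·b + α) · X^{p·b}`. -/
noncomputable def barComponent (p : ℕ) {d : ℕ} (Γ : MvPolynomial (Fin d) (ZMod p))
    (α : Fin d → Fin p) : MvPolynomial (Fin d) (ZMod p) :=
  ∑ m ∈ Γ.support.filter (fun m => ∀ i, m i % p = (α i : ℕ)),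
    MvPolynomial.monomial (m - Finsupp.equivFunOnFinite.symm fun i => ((α i : ℕ)))
      (Γ.coeff m)

/-- `A_β = ∑_{α ∈ {0,…,p−1}^d} (∏_i R_i^{α_i+β_i})' · Γ̄_α`, an element of
`𝔽_p[x][X_1,…,X_d]` where the derivative factors are constant coefficients. -/
noncomputable def Abeta (p : ℕ) {d : ℕ} (R : Fin d → Polynomial (ZMod p))
    (Γ : MvPolynomial (Fin d) (ZMod p)) (β : Fin d → Fin p) :
    MvPolynomial (Fin d) (Polynomial (ZMod p)) :=
  ∑ α : Fin d → Fin p,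
    MvPolynomial.C (Polynomial.derivative (∏ i, R i ^ ((α i : ℕ) + (β i : ℕ)))) *
      MvPolynomial.map (Polynomial.C : ZMod p →+* Polynomial (ZMod p))
        (barComponent p Γ α)

open MvPolynomial in
theorem aeval_barComponent (p : ℕ) {d : ℕ} (R : Fin d → Polynomial (ZMod p))
    (Γ : MvPolynomial (Fin d) (ZMod p)) (α : Fin d → Fin p) :
    aeval R (barComponent p Γ α) =
      ∑ m ∈ Γ.support.filter (fun m => ∀ i, m i % p = (α i : ℕ)),
        Polynomial.C (Γ.coeff m) * ∏ i, R i ^ (m i - (α i : ℕ)) := by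
  simp [barComponent, aeval_monomial, Finsupp.prod_fintype]

open MvPolynomial in
theorem derivative_aeval_barComponent (p : ℕ) {d : ℕ} (R : Fin d → Polynomial (ZMod p))
    (Γ : MvPolynomial (Fin d) (ZMod p)) (α : Fin d → Fin p) :
    Polynomial.derivative (aeval R (barComponent p Γ α)) = 0 := by
  rw [aeval_barComponent, Polynomial.derivative_sum]
  refine Finset.sum_eq_zero fun m hm => ?_
  have hmod := (Finset.mem_filter.mp hm).2
  have hpow : ∏ i, R i ^ (m i - (α i : ℕ)) = (∏ i, R i ^ (m i / p)) ^ p := by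
    rw [← Finset.prod_pow]
    refine Finset.prod_congr rfl fun i _ => ?_
    rw [← pow_mul, ← hmod i, Nat.sub_eq_of_eq_add (Nat.div_add_mod' (m i) p).symm]
  rw [hpow, Polynomial.derivative_C_mul, Polynomial.derivative_pow]
  simp

open MvPolynomial in
theorem sum_prod_pow_mul_aeval_barComponent (p : ℕ) [Fact p.Prime] {d : ℕ}
    (R : Fin d → Polynomial (ZMod p)) (Γ : MvPolynomial (Fin d) (ZMod p)) :
    ∑ α : Fin d → Fin p, (∏ i, R i ^ (α i : ℕ)) * aeval R (barComponent p Γ α) =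
      aeval R Γ := by
  rw [aeval_def, eval₂_eq', ← Finset.sum_fiberwise Γ.support
    fun m i => (⟨m i % p, Nat.mod_lt _ (Fact.out : p.Prime).pos⟩ : Fin p)]
  refine Finset.sum_congr rfl fun α _ => ?_
  rw [aeval_barComponent, Finset.mul_sum]
  refine Finset.sum_congr (by ext m; simp [funext_iff, Fin.ext_iff]) fun m hm => ?_
  have hmod : ∀ i, m i % p = (α i : ℕ) := by simpa [funext_iff, Fin.ext_iff] using
    (Finset.mem_filter.mp hm).2
  rw [mul_left_comm, ← Finset.prod_mul_distrib]
  congr 1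
  refine Finset.prod_congr rfl fun i _ => ?_
  rw [← pow_add, ← hmod i, Nat.add_sub_cancel' (Nat.mod_le _ _)]

theorem stmt_13 (p : ℕ) [Fact p.Prime] (d : ℕ) (hd : 1 ≤ d)
    (R : Fin d → Polynomial (ZMod p))
    (Γ : MvPolynomial (Fin d) (ZMod p))
    (hΓ : MvPolynomial.aeval R Γ = 0)
    (β : Fin d → Fin p) :
    (MvPolynomial.aeval R :
        MvPolynomial (Fin d) (Polynomial (ZMod p)) →ₐ[Polynomial (ZMod p)]
          Polynomial (ZMod p)) (Abeta p R Γ β) = 0 := by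
  have hmap (q : MvPolynomial (Fin d) (ZMod p)) :
      MvPolynomial.aeval R (MvPolynomial.map (Polynomial.C : ZMod p →+* Polynomial (ZMod p)) q) =
        MvPolynomial.aeval R q :=
    MvPolynomial.aeval_map_algebraMap (Polynomial (ZMod p)) R q
  have hsum : ∑ α : Fin d → Fin p, (∏ i, R i ^ ((α i : ℕ) + (β i : ℕ))) *
      MvPolynomial.aeval R (barComponent p Γ α) = 0 := by
    rw [← mul_zero (∏ i, R i ^ (β i : ℕ)), ← hΓ, ← sum_prod_pow_mul_aeval_barComponent p R Γ,
      Finset.mul_sum]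
    refine Finset.sum_congr rfl fun α _ => ?_
    simp only [pow_add, Finset.prod_mul_distrib]
    ring
  have hder := congrArg Polynomial.derivative hsum
  simp only [Polynomial.derivative_sum, Polynomial.derivative_mul, derivative_aeval_barComponent,
    mul_zero, add_zero, Polynomial.derivative_zero] at hder
  simpa only [Abeta, map_sum, map_mul, MvPolynomial.aeval_C, hmap, Algebra.algebraMap_self_apply]
    using hder
end
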